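/- If a nonempty convex subset A of a uniquely geodesic metric space is unbounded in the sense of containing a geodesic ray, then the man wins the Lion-Man game for any jump bound D > 0: starting with L_0 = γ(0) and M_0 = γ(D+1) on a geodesic ray γ, the man can move so that d(L_i, M_i) = D+1 for all i, hence lim_i d(L_{i+1}, M_i) = 1 > 0. -/

import Mathlib

open Set Filter Topology

/-- `γ` restricted to `[0, l]` is a geodesic (isometric embedding). -/
def IsGeodesicOn {X : Type*} [MetricSpace X] (γ : ℝ → X) (l : ℝ) : Prop :=
  ∀ s ∈ Set.Icc (0:ℝ) l, ∀ t ∈ Set.Icc (0:ℝ) l, dist (γ s) (γ t) = |s - t|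

/-- `γ` is a local geodesic on `[0, l]`: every parameter has a nontrivial closed
interval around it (containing it in its interior) on whose intersection with
`[0, l]` the map `γ` is a geodesic. -/
def IsLocalGeodesicOn {X : Type*} [MetricSpace X] (γ : ℝ → X) (l : ℝ) : Prop :=
  ∀ t ∈ Set.Icc (0:ℝ) l, ∃ a b : ℝ, a < t ∧ t < b ∧
    ∀ s ∈ Set.Icc a b ∩ Set.Icc (0:ℝ) l, ∀ s' ∈ Set.Icc a b ∩ Set.Icc (0:ℝ) l,
      dist (γ s) (γ s') = |s - s'|

/-- The geodesic segment `[x,y]`, described via metric betweenness: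
`p ∈ [x,y]` iff `d(x,p) + d(p,y) = d(x,y)`. -/
def GeodSegment {X : Type*} [MetricSpace X] (x y : X) : Set X :=
  {p | dist x p + dist p y = dist x y}

/-- Every pair of points is joined by a geodesic, and it is unique. -/
def UniquelyGeodesic (X : Type*) [MetricSpace X] : Prop :=
  ∀ x y : X,
    (∃ γ : ℝ → X, γ 0 = x ∧ γ (dist x y) = y ∧ IsGeodesicOn γ (dist x y)) ∧
    ∀ γ₁ γ₂ : ℝ → X,
      γ₁ 0 = x → γ₁ (dist x y) = y → IsGeodesicOn γ₁ (dist x y) →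
      γ₂ 0 = x → γ₂ (dist x y) = y → IsGeodesicOn γ₂ (dist x y) →
      ∀ t ∈ Set.Icc (0:ℝ) (dist x y), γ₁ t = γ₂ t

/-- `A` is (geodesically) convex: it contains the geodesic segment between any
two of its points. -/
def GeodConvex {X : Type*} [MetricSpace X] (A : Set X) : Prop :=
  ∀ x ∈ A, ∀ y ∈ A, GeodSegment x y ⊆ A

/-- `γ` is a local geodesic on `[0, l]` lying in `A`. -/
def LocalGeodesicIn {X : Type*} [MetricSpace X] (A : Set X) (γ : ℝ → X) (l : ℝ) : Prop :=
  IsLocalGeodesicOn γ l ∧ ∀ t ∈ Set.Icc (0:ℝ) l, γ t ∈ A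

/-- `A` is strongly convex: it is convex, and there is no local geodesic in `A`
joining two of its points other than the geodesic segment (i.e. the image of any
local geodesic in `A` is exactly the geodesic segment between its endpoints). -/
def StronglyConvexSet {X : Type*} [MetricSpace X] (A : Set X) : Prop :=
  GeodConvex A ∧ ∀ (γ : ℝ → X) (l : ℝ), 0 ≤ l → LocalGeodesicIn A γ l →
    γ '' Set.Icc (0:ℝ) l = GeodSegment (γ 0) (γ l)

/-- The betweenness property for `A`. -/
def BetweennessProperty {X : Type*} [MetricSpace X] (A : Set X) : Prop :=
  ∀ x ∈ A, ∀ y ∈ A, ∀ z ∈ A, ∀ w ∈ A,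
    x ≠ y → x ≠ z → x ≠ w → y ≠ z → y ≠ w → z ≠ w →
    y ∈ GeodSegment x z → z ∈ GeodSegment y w →
    y ∈ GeodSegment x w ∧ z ∈ GeodSegment x w

/-- A geodesic ray contained in `A`. -/
def GeodesicRayIn {X : Type*} [MetricSpace X] (A : Set X) (γ : ℝ → X) : Prop :=
  (∀ t : ℝ, 0 ≤ t → γ t ∈ A) ∧
  ∀ s t : ℝ, 0 ≤ s → 0 ≤ t → dist (γ s) (γ t) = |s - t|

/-- The rules of the discrete Lion-Man game with jump bound `D` played in `A`. -/
def LionManRules {X : Type*} [MetricSpace X] (A : Set X) (D : ℝ) (L M : ℕ → X) : Prop :=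
  L 0 ∈ A ∧ (∀ i, M i ∈ A) ∧
  (∀ i, L (i+1) ∈ GeodSegment (L i) (M i)) ∧
  (∀ i, dist (L i) (L (i+1)) = min D (dist (L i) (M i))) ∧
  (∀ i, dist (M i) (M (i+1)) ≤ D)

/-- The lion wins: `d(L_{i+1}, M_i) → 0`. -/
def LionWins {X : Type*} [MetricSpace X] (L M : ℕ → X) : Prop :=
  Filter.Tendsto (fun i => dist (L (i+1)) (M i)) Filter.atTop (nhds 0)

/-- If a nonempty convex subset `A` of a uniquely geodesic space
contains a geodesic ray, then for any `D > 0` the man wins: starting from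
`L₀ = γ(0)`, `M₀ = γ(D+1)`, he can play keeping `d(L_i, M_i) = D + 1`, so that
`d(L_{i+1}, M_i) = 1` for all `i` and hence `d(L_{i+1}, M_i) → 1 > 0`. -/
theorem stmt11 {X : Type*} [MetricSpace X] (hX : UniquelyGeodesic X)
    (A : Set X) (hne : A.Nonempty) (hA : GeodConvex A)
    (γ : ℝ → X) (hray : GeodesicRayIn A γ)
    (D : ℝ) (hD : 0 < D) :
    ∃ L M : ℕ → X, LionManRules A D L M ∧
      L 0 = γ 0 ∧ M 0 = γ (D + 1) ∧
      (∀ i, dist (L i) (M i) = D + 1) ∧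
      (∀ i, dist (L (i + 1)) (M i) = 1) ∧
      Filter.Tendsto (fun i => dist (L (i + 1)) (M i)) Filter.atTop (nhds 1) ∧
      (1 : ℝ) > 0 := by
  obtain ⟨hmem, hd⟩ := hray
  have hi : ∀ i : ℕ, 0 ≤ (i : ℝ) * D := fun i => by positivity
  have hLM : ∀ i : ℕ, dist (γ (i * D)) (γ (i * D + D + 1)) = D + 1 := by
    intro i
    rw [hd _ _ (hi i) (by linarith [hi i]), abs_sub_comm, abs_of_nonneg] <;> linarith
  have hLL : ∀ i : ℕ, dist (γ (i * D)) (γ ((i + 1 : ℕ) * D)) = D := by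
    intro i
    rw [hd _ _ (hi i) (hi _), abs_sub_comm, abs_of_nonneg] <;> push_cast <;> linarith
  have hL1 : ∀ i : ℕ, dist (γ ((i + 1 : ℕ) * D)) (γ (i * D + D + 1)) = 1 := by
    intro i
    rw [hd _ _ (hi _) (by linarith [hi i]), abs_sub_comm, abs_of_nonneg] <;>
      push_cast <;> linarith
  have hMM : ∀ i : ℕ, dist (γ (i * D + D + 1)) (γ ((i + 1 : ℕ) * D + D + 1)) = D := by
    intro i
    rw [hd _ _ (by linarith [hi i]) (by linarith [hi (i + 1)]), abs_sub_comm, abs_of_nonneg] <;>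
      push_cast <;> linarith
  refine ⟨fun i => γ (i * D), fun i => γ (i * D + D + 1),
    ⟨hmem _ (hi 0), fun i => hmem _ (by linarith [hi i]), fun i => ?_, fun i => ?_,
      fun i => (hMM i).le⟩, by simp, by simp, hLM, hL1, ?_, one_pos⟩
  · change dist _ _ + dist _ _ = dist _ _
    rw [hLL, hL1, hLM]
  · change dist _ _ = min D (dist _ _)
    rw [hLL, hLM, min_eq_left (by linarith)]
  · exact tendsto_const_nhds.congr fun i => (hL1 i).symm
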